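/- Let Λ ⊆ ℍ be an axially symmetric s-domain and let f, g : Λ → ℍ both be slice regular on Λ and satisfy the quaternionic C-property (f(conj q) = conj(f(q)) and g(conj q) = conj(g(q)) for all q ∈ Λ). Then the pointwise products commute: f(q)·g(q) = g(q)·f(q) for every q ∈ Λ. -/

import Mathlib

open MeasureTheory Complex Quaternion

noncomputable section

/-- The sphere of imaginary units of the quaternions. -/
def Sph : Set ℍ[ℝ] := {I | I.re = 0 ∧ ‖I‖ = 1}

/-- `Λ ⊆ ℍ` is axially symmetric. -/
def AxSymm (Λ : Set ℍ[ℝ]) : Prop :=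
  ∀ (x y : ℝ), (∃ J ∈ Sph, (x : ℍ[ℝ]) + y • J ∈ Λ) → ∀ I ∈ Sph, (x : ℍ[ℝ]) + y • I ∈ Λ

/-- The complex plane `ℂ(I) = {x + yI : x, y ∈ ℝ}` inside the quaternions. -/
def CSlice (I : ℍ[ℝ]) : Set ℍ[ℝ] := {q | ∃ x y : ℝ, q = (x : ℍ[ℝ]) + y • I}

/-- `Λ` is an s-domain: an open connected set intersecting the real axis whose
intersection with each slice `ℂ(I)` is connected. -/
def IsSDomain (Λ : Set ℍ[ℝ]) : Prop :=
  IsOpen Λ ∧ IsConnected Λ ∧ (∃ r : ℝ, (r : ℍ[ℝ]) ∈ Λ) ∧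
    ∀ I ∈ Sph, IsConnected (Λ ∩ CSlice I)

/-- `f` is (left) slice regular on `Λ`: it is real-differentiable on `Λ` and on each
slice it satisfies `∂f/∂x + I ∂f/∂y = 0`. -/
def SliceRegular (Λ : Set ℍ[ℝ]) (f : ℍ[ℝ] → ℍ[ℝ]) : Prop :=
  DifferentiableOn ℝ f Λ ∧
  ∀ I ∈ Sph, ∀ x y : ℝ, (x : ℍ[ℝ]) + y • I ∈ Λ →
    deriv (fun t : ℝ => f ((t : ℍ[ℝ]) + y • I)) x
      + I * deriv (fun t : ℝ => f ((x : ℍ[ℝ]) + t • I)) y = 0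

/-- The quaternionic C-property of a function on `Λ`. -/
def QCProp (Λ : Set ℍ[ℝ]) (f : ℍ[ℝ] → ℍ[ℝ]) : Prop :=
  ∀ q ∈ Λ, f (star q) = star (f q)

/-- The slice `Ω_𝐢 ⊆ ℂ` of `Λ` in the plane determined by `𝐢`. -/
def SliceSet (Λ : Set ℍ[ℝ]) (i : ℍ[ℝ]) : Set ℂ :=
  {z | (z.re : ℍ[ℝ]) + z.im • i ∈ Λ}

/-- The embedding `ι : ℂ → ℂ(𝐢) ⊆ ℍ`, `a + b i ↦ a + b 𝐢`. -/
def toSlice (i : ℍ[ℝ]) (z : ℂ) : ℍ[ℝ] := (z.re : ℍ[ℝ]) + z.im • i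

/-- `Ω` is invariant under complex conjugation. -/
def ZInvariant (Ω : Set ℂ) : Prop := ∀ z ∈ Ω, (starRingEnd ℂ) z ∈ Ω

/-- `f` is holomorphic on `Ω`: complex-differentiable at every point of `Ω`. -/
def HolomorphicOn (Ω : Set ℂ) (f : ℂ → ℂ) : Prop := ∀ z ∈ Ω, DifferentiableAt ℂ f z

/-- `f` satisfies the C-property on `Ω`. -/
def CProp (Ω : Set ℂ) (f : ℂ → ℂ) : Prop := ∀ z ∈ Ω, f ((starRingEnd ℂ) z) = (starRingEnd ℂ) (f z)

/-- `f` satisfies the anti-C-property on `Ω`. -/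
def AntiCProp (Ω : Set ℂ) (f : ℂ → ℂ) : Prop := ∀ z ∈ Ω, f ((starRingEnd ℂ) z) = -(starRingEnd ℂ) (f z)

theorem Sph.mul_self {i : ℍ[ℝ]} (hi : i ∈ Sph) : i * i = -1 := by
  obtain ⟨h0, h1⟩ := hi
  have h2 : star i = -i := Quaternion.star_eq_neg.2 h0
  have h3 := Quaternion.self_mul_star i
  rw [h2, Quaternion.normSq_eq_norm_mul_self, h1] at h3
  rw [← neg_inj, ← mul_neg, h3]
  simp

theorem Sph.sq_sum {i : ℍ[ℝ]} (hi : i ∈ Sph) :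
    i.imI ^ 2 + i.imJ ^ 2 + i.imK ^ 2 = 1 := by
  have h := congrArg (fun q : ℍ[ℝ] => q.re) (Sph.mul_self hi)
  simp [hi.1] at h
  linarith

/-- Every quaternion lies in the slice of some imaginary unit. -/
theorem exists_mem_Sph_eq_toSlice (q : ℍ[ℝ]) : ∃ i ∈ Sph, ∃ z : ℂ, q = toSlice i z := by
  by_cases h : q.im = 0
  · obtain ⟨j, h0, h1, h2, h3⟩ : ∃ j : ℍ[ℝ], j.re = 0 ∧ j.imI = 1 ∧ j.imJ = 0 ∧ j.imK = 0 :=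
      ⟨⟨0, 1, 0, 0⟩, rfl, rfl, rfl, rfl⟩
    refine ⟨j, ⟨h0, ?_⟩, (q.re : ℂ), ?_⟩
    · have hn := Quaternion.normSq_eq_norm_mul_self j
      rw [Quaternion.normSq_def', h0, h1, h2, h3] at hn
      nlinarith [norm_nonneg j]
    · simpa [toSlice, h] using (Quaternion.re_add_im q).symm
  · have hn : ‖q.im‖ ≠ 0 := norm_ne_zero_iff.2 h
    refine ⟨‖q.im‖⁻¹ • q.im, ⟨by simp, ?_⟩, ⟨q.re, ‖q.im‖⟩, ?_⟩
    · rw [norm_smul, norm_inv, norm_norm, inv_mul_cancel₀ hn]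
    · rw [toSlice, smul_inv_smul₀ hn]
      exact (Quaternion.re_add_im q).symm

theorem commute_of_commute_mem_Sph {i p q : ℍ[ℝ]} (hi : i ∈ Sph)
    (hp : Commute p i) (hq : Commute q i) : Commute p q := by
  have hs := Sph.sq_sum hi
  have key : ∀ v : ℍ[ℝ], Commute v i → ∃ a b : ℝ, v = (a : ℍ[ℝ]) + b • i := by
    intro v hv
    have e := hv.eq
    have e1 := congrArg (fun q : ℍ[ℝ] => q.imI) e
    have e2 := congrArg (fun q : ℍ[ℝ] => q.imJ) e
    have e3 := congrArg (fun q : ℍ[ℝ] => q.imK) e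
    simp [hi.1] at e1 e2 e3
    refine ⟨v.re, v.imI * i.imI + v.imJ * i.imJ + v.imK * i.imK, ?_⟩
    ext
    · simp [hi.1]
    · simp
      linear_combination -v.imI * hs + i.imJ / 2 * e3 - i.imK / 2 * e2
    · simp
      linear_combination -v.imJ * hs + i.imK / 2 * e1 - i.imI / 2 * e3
    · simp
      linear_combination -v.imK * hs + i.imI / 2 * e2 - i.imJ / 2 * e1
  obtain ⟨a, b, rfl⟩ := key p hp
  exact (Quaternion.coe_commute a q).add_left (hq.symm.smul_left b)

theorem continuous_toSlice (i : ℍ[ℝ]) : Continuous (toSlice i) := by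
  unfold toSlice
  exact (Quaternion.continuous_coe.comp Complex.continuous_re).add
    (Complex.continuous_im.smul continuous_const)

theorem isOpen_sliceSet {Λ : Set ℍ[ℝ]} (hΛ : IsOpen Λ) (i : ℍ[ℝ]) : IsOpen (SliceSet Λ i) :=
  hΛ.preimage (continuous_toSlice i)

theorem isPreconnected_sliceSet {Λ : Set ℍ[ℝ]} {i : ℍ[ℝ]} (hi : i ∈ Sph)
    (h : IsConnected (Λ ∩ CSlice i)) : IsPreconnected (SliceSet Λ i) := by
  have hinv : ∀ x y : ℝ, (⟨((x : ℍ[ℝ]) + y • i).re, -(((x : ℍ[ℝ]) + y • i) * i).re⟩ : ℂ)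
      = ⟨x, y⟩ := by
    intro x y
    rw [add_mul, smul_mul_assoc, Sph.mul_self hi]
    simp [hi.1]
  have hc : Continuous (fun q : ℍ[ℝ] => (⟨q.re, -(q * i).re⟩ : ℂ)) := by
    have : Continuous (fun q : ℍ[ℝ] => (q.re : ℂ) + (-(q * i).re : ℝ) * Complex.I) := by
      have h1 := Quaternion.continuous_re
      fun_prop
    convert this using 2
    exact Complex.mk_eq_add_mul_I _ _
  convert h.isPreconnected.image _ hc.continuousOn using 1
  ext z
  constructor
  · intro hz
    exact ⟨_, ⟨hz, z.re, z.im, rfl⟩, hinv _ _⟩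
  · rintro ⟨_, ⟨hq, x, y, rfl⟩, rfl⟩
    simp only [hinv]
    exact hq

/-- Composing a slice regular function, restricted to a slice, with a map that is complex linear
for left multiplication by the imaginary unit gives a holomorphic function. -/
theorem SliceRegular.differentiableAt_comp {Λ : Set ℍ[ℝ]} {f : ℍ[ℝ] → ℍ[ℝ]}
    (hf : SliceRegular Λ f) (hΛ : IsOpen Λ) {i : ℍ[ℝ]} (hi : i ∈ Sph) (L : ℍ[ℝ] →L[ℝ] ℂ)
    (hL : ∀ v, L (i * v) = Complex.I * L v) {z : ℂ} (hz : z ∈ SliceSet Λ i) :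
    DifferentiableAt ℂ (fun w => L (f (toSlice i w))) z := by
  have hd : HasFDerivAt f (fderiv ℝ f (toSlice i z)) (toSlice i z) :=
    (hf.1.differentiableAt (hΛ.mem_nhds hz)).hasFDerivAt
  let T : ℂ →L[ℝ] ℍ[ℝ] := LinearMap.toContinuousLinearMap
    { toFun := toSlice i
      map_add' := fun a b => by simp [toSlice, add_smul]; abel
      map_smul' := fun c a => by
        simp [toSlice, mul_smul, ← Quaternion.coe_mul_eq_smul] }
  have hT : HasFDerivAt (toSlice i) T z := T.hasFDerivAt
  have hx : HasDerivAt (fun t : ℝ => (t : ℍ[ℝ]) + z.im • i) 1 z.re := by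
    have h := (Algebra.linearMap ℝ ℍ[ℝ]).toContinuousLinearMap.hasDerivAt (x := z.re)
    simpa using h.add_const (z.im • i)
  have hy : HasDerivAt (fun t : ℝ => (z.re : ℍ[ℝ]) + t • i) i z.im := by
    simpa using ((hasDerivAt_id z.im).smul_const i).const_add (z.re : ℍ[ℝ])
  have hcr := hf.2 i hi z.re z.im hz
  have e1 := (hd.comp_hasDerivAt z.re hx).deriv
  have e2 := (hd.comp_hasDerivAt z.im hy).deriv
  simp only [Function.comp_def] at e1 e2
  rw [e1, e2] at hcr
  have hall := L.hasFDerivAt.comp z (hd.comp z hT)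
  have hT1 : T 1 = 1 := by simp [T, toSlice]
  have hTI : T Complex.I = i := by simp [T, toSlice]
  refine differentiableAt_complex_iff_differentiableAt_real.2 ⟨hall.differentiableAt, ?_⟩
  have hfd := hall.fderiv
  simp only [Function.comp_def] at hfd
  rw [hfd]
  simp only [ContinuousLinearMap.comp_apply, hT1, hTI, smul_eq_mul]
  rw [← hL, eq_neg_of_add_eq_zero_left hcr, mul_neg, ← mul_assoc, Sph.mul_self hi]
  simp

open Filter Topology in
/-- A slice regular function with the C-property maps each slice into itself. -/
theorem SliceRegular.commute_of_qcProp {Λ : Set ℍ[ℝ]} {f : ℍ[ℝ] → ℍ[ℝ]} (hs : IsSDomain Λ)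
    (hf : SliceRegular Λ f) (hc : QCProp Λ f) {i : ℍ[ℝ]} (hi : i ∈ Sph) {z : ℂ}
    (hz : z ∈ SliceSet Λ i) : Commute (f (toSlice i z)) i := by
  obtain ⟨hΛ, -, ⟨r, hr⟩, hconn⟩ := hs
  have hii := Sph.mul_self hi
  have main : ∀ b : ℍ[ℝ], ((f (toSlice i z) * i - i * f (toSlice i z)) * b).re = 0 := by
    intro b
    let L : ℍ[ℝ] →L[ℝ] ℂ := LinearMap.toContinuousLinearMap
      { toFun := fun v => (((v * i - i * v) * b).re : ℂ)
          - Complex.I * ((i * ((v * i - i * v) * b)).re : ℂ)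
        map_add' := fun v w => by
          rw [show (v + w) * i - i * (v + w) = (v * i - i * v) + (w * i - i * w) by noncomm_ring,
            add_mul, mul_add, Quaternion.re_add, Quaternion.re_add]
          push_cast
          ring
        map_smul' := fun c v => by
          rw [smul_mul_assoc, mul_smul_comm, ← smul_sub, smul_mul_assoc, mul_smul_comm,
            Quaternion.re_smul, Quaternion.re_smul]
          simp
          ring }
    have hLdef : ∀ v, L v = (((v * i - i * v) * b).re : ℂ)
          - Complex.I * ((i * ((v * i - i * v) * b)).re : ℂ) := fun v => rfl
    have hL : ∀ v, L (i * v) = Complex.I * L v := by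
      intro v
      rw [hLdef, hLdef,
        show (i * v * i - i * (i * v)) * b = i * ((v * i - i * v) * b) by noncomm_ring,
        ← mul_assoc i i, hii]
      simp only [neg_mul, one_mul, Quaternion.re_neg]
      push_cast
      linear_combination ((i * ((v * i - i * v) * b)).re : ℂ) * Complex.I_mul_I
    have hopen := isOpen_sliceSet hΛ i
    have han : AnalyticOnNhd ℂ (fun w => L (f (toSlice i w))) (SliceSet Λ i) :=
      DifferentiableOn.analyticOnNhd
        (fun w hw => (hf.differentiableAt_comp hΛ hi L hL hw).differentiableWithinAt) hopen
    have hreal : ∀ t : ℝ, (t : ℍ[ℝ]) ∈ Λ → L (f (toSlice i (t : ℂ))) = 0 := by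
      intro t ht
      have h1 := hc _ ht
      rw [Quaternion.star_coe] at h1
      have h2 : f (t : ℍ[ℝ]) = ((f (t : ℍ[ℝ])).re : ℍ[ℝ]) := Quaternion.star_eq_self.1 h1.symm
      have h3 : toSlice i (t : ℂ) = (t : ℍ[ℝ]) := by simp [toSlice]
      rw [hLdef, h3, h2, (Quaternion.coe_commute _ i).eq]
      simp
    have hr' : (r : ℂ) ∈ SliceSet Λ i := by simpa [SliceSet] using hr
    have hfreq : ∃ᶠ w in 𝓝[≠] (r : ℂ), L (f (toSlice i w)) = 0 := by
      have ht : Tendsto (fun t : ℝ => (t : ℂ)) (𝓝[≠] r) (𝓝[≠] (r : ℂ)) :=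
        Complex.continuous_ofReal.continuousAt.continuousWithinAt.tendsto_nhdsWithin
          (fun t ht => by simpa using ht)
      refine ht.frequently (Eventually.frequently ?_)
      have h4 : ∀ᶠ t : ℝ in 𝓝 r, (t : ℍ[ℝ]) ∈ Λ :=
        Quaternion.continuous_coe.continuousAt.eventually (hΛ.mem_nhds hr)
      exact (h4.filter_mono nhdsWithin_le_nhds).mono hreal
    have h0 := han.eqOn_zero_of_preconnected_of_frequently_eq_zero
      (isPreconnected_sliceSet hi (hconn i hi)) hr' hfreq hz
    have h5 := congrArg Complex.re h0
    simpa [hLdef] using h5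
  have h6 := main (star (f (toSlice i z) * i - i * f (toSlice i z)))
  rw [Quaternion.self_mul_star, Quaternion.re_coe, Quaternion.normSq_eq_zero] at h6
  exact sub_eq_zero.1 h6

theorem stmt16 (Λ : Set ℍ[ℝ]) (hs : IsSDomain Λ) (hax : AxSymm Λ)
    (f g : ℍ[ℝ] → ℍ[ℝ])
    (hf : SliceRegular Λ f) (hg : SliceRegular Λ g)
    (hcf : QCProp Λ f) (hcg : QCProp Λ g) :
    ∀ q ∈ Λ, f q * g q = g q * f q := by
  intro q hq
  obtain ⟨i, hi, z, rfl⟩ := exists_mem_Sph_eq_toSlice q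
  exact commute_of_commute_mem_Sph hi (hf.commute_of_qcProp hs hcf hi hq)
    (hg.commute_of_qcProp hs hcg hi hq)
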